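/- Let k_w(v, v*) = w^ℓ(v) k(v, v*) w^{-ℓ}(v*) with w^ℓ(v) = (1+|v|²)^ℓ, ℓ ≥ 0, and k(v,v*) = k₂(v,v*) - k₁(v,v*) where k₁(v,v*) = C̃₁ |v-v*|^γ e^{-(|v|²+|v*|²)/4} and k₂(v,v*) = C̃₂ |v-v*|^{-2+γ} e^{-|v-v*|²/8 - ||v|²-|v*|²|²/(8|v-v*|²)}, 0 ≤ γ ≤ 1. Then for ε ≥ 0 small enough there exists C > 0 such that ∫_{ℝ³} |k_w(v, v*)| e^{ε |v-v*|²/16} dv* ≤ C (1 + |v|)^{-1} for all v ∈ ℝ³. -/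

import Mathlib

open Real MeasureTheory Set
open scoped ENNReal

/-- The image of planar Lebesgue measure under `x ↦ |x|²` is `π` times Lebesgue measure on the
positive half-line. -/
theorem lintegral_comp_sq_add_sq (G : ℝ → ℝ≥0∞) (hG : Measurable G) :
    ∫⁻ x : ℝ × ℝ, G (x.1 ^ 2 + x.2 ^ 2) = ENNReal.ofReal π * ∫⁻ s in Ioi 0, G s := by
  have himage : (fun r : ℝ => r ^ 2) '' Ioi 0 = Ioi 0 := by
    ext s
    constructor
    · rintro ⟨r, hr, rfl⟩
      exact pow_pos (mem_Ioi.1 hr) 2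
    · intro hs
      exact ⟨√s, sqrt_pos.2 hs, sq_sqrt (le_of_lt hs)⟩
  have hradial : ∫⁻ s in Ioi 0, G s =
      ∫⁻ r in Ioi (0 : ℝ), ENNReal.ofReal |2 * r| * G (r ^ 2) := by
    conv_lhs => rw [← himage]
    refine lintegral_image_eq_lintegral_abs_deriv_mul measurableSet_Ioi (f' := fun r => 2 * r)
      (fun r _ => ?_) (fun r hr s hs h => ?_) G
    · simpa using (hasDerivAt_pow 2 r).hasDerivWithinAt
    · exact (sq_eq_sq₀ (le_of_lt hr) (le_of_lt hs)).1 h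
  rw [← lintegral_comp_polarCoord_symm, hradial]
  have hpolar (p : ℝ × ℝ) :
      ENNReal.ofReal p.1 • G ((polarCoord.symm p).1 ^ 2 + (polarCoord.symm p).2 ^ 2) =
        (ENNReal.ofReal p.1 * G (p.1 ^ 2)) * 1 := by
    have : (p.1 * cos p.2) ^ 2 + (p.1 * sin p.2) ^ 2 = p.1 ^ 2 := by
      rw [mul_pow, mul_pow, ← mul_add, cos_sq_add_sin_sq, mul_one]
    simp [polarCoord_symm_apply, this]
  simp_rw [hpolar]
  have htarget : polarCoord.target = Ioi (0 : ℝ) ×ˢ Ioo (-π) π := rfl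
  rw [htarget, Measure.volume_eq_prod, ← Measure.prod_restrict,
    lintegral_prod_mul (f := fun r : ℝ => ENNReal.ofReal r * G (r ^ 2))
      (g := fun _ : ℝ => (1 : ℝ≥0∞)) (by fun_prop) (by fun_prop), lintegral_one,
    Measure.restrict_apply_univ, Real.volume_Ioo, mul_comm,
    ← lintegral_const_mul _ (by fun_prop), ← lintegral_const_mul _ (by fun_prop)]
  refine setLIntegral_congr_fun measurableSet_Ioi fun r hr => ?_
  have hr' : (0 : ℝ) ≤ r := le_of_lt hr
  rw [abs_of_nonneg (by positivity), ← mul_assoc, ← mul_assoc,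
    ← ENNReal.ofReal_mul (by linarith [pi_pos]), ← ENNReal.ofReal_mul pi_pos.le]
  ring_nf

/-- Archimedes' hat-box principle: in three dimensions, the coordinate `⟪e, u⟫` along a unit
vector and `‖u‖²` have joint density `π` on `{a² < p}`. -/
theorem lintegral_comp_inner_normSq (F : ℝ → ℝ → ℝ≥0∞) (hF : Measurable (Function.uncurry F))
    (e : EuclideanSpace ℝ (Fin 3)) (he : ‖e‖ = 1) :
    ∫⁻ u : EuclideanSpace ℝ (Fin 3), F (inner ℝ e u) (‖u‖ ^ 2) =
      ENNReal.ofReal π * ∫⁻ a : ℝ, ∫⁻ p in Ioi (a ^ 2), F a p := by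
  have horth : Orthonormal ℝ (({0} : Set (Fin 3)).domRestrict fun _ => e) := by
    refine ⟨fun i => he, fun i j hij => ?_⟩
    exact absurd (Subsingleton.elim i j) hij
  obtain ⟨b, hb⟩ := horth.exists_orthonormalBasis_extension_of_card_eq (by simp)
  have hb0 : b 0 = e := hb 0 rfl
  have hcoord : MeasurePreserving (fun u : EuclideanSpace ℝ (Fin 3) =>
      (b.repr u 0, (b.repr u 1, b.repr u 2))) volume volume := by
    have h1 := b.measurePreserving_repr
    have h2 := EuclideanSpace.volume_preserving_symm_measurableEquiv_toLp (Fin 3)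
    have h3 := volume_preserving_piFinSuccAbove (fun _ : Fin 3 => ℝ) 0
    have h4 := (MeasurePreserving.id (volume : Measure ℝ)).prod (volume_preserving_finTwoArrow ℝ)
    exact h4.comp (h3.comp (h2.comp h1))
  have hnorm (u : EuclideanSpace ℝ (Fin 3)) :
      ‖u‖ ^ 2 = b.repr u 0 ^ 2 + (b.repr u 1 ^ 2 + b.repr u 2 ^ 2) := by
    rw [← b.repr.norm_map, EuclideanSpace.norm_sq_eq, Fin.sum_univ_three]
    simp [add_assoc]
  have hinner (u : EuclideanSpace ℝ (Fin 3)) : inner ℝ e u = b.repr u 0 := by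
    rw [b.repr_apply_apply, hb0]
  simp_rw [hnorm, hinner]
  have hmeas : Measurable fun x : ℝ × ℝ × ℝ => F x.1 (x.1 ^ 2 + (x.2.1 ^ 2 + x.2.2 ^ 2)) :=
    hF.comp (by fun_prop : Measurable fun x : ℝ × ℝ × ℝ =>
      (x.1, x.1 ^ 2 + (x.2.1 ^ 2 + x.2.2 ^ 2)))
  rw [hcoord.lintegral_comp (f := fun x : ℝ × ℝ × ℝ =>
      F x.1 (x.1 ^ 2 + (x.2.1 ^ 2 + x.2.2 ^ 2))) hmeas, Measure.volume_eq_prod,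
    lintegral_prod _ hmeas.aemeasurable, ← lintegral_const_mul' _ _ ENNReal.ofReal_ne_top]
  refine lintegral_congr fun a => ?_
  have hFa : Measurable (F a) := hF.comp measurable_prodMk_left
  rw [lintegral_comp_sq_add_sq (fun s => F a (a ^ 2 + s)) (by fun_prop)]
  congr 1
  have := (measurePreserving_add_left volume (a ^ 2)).setLIntegral_comp_preimage
    (measurableSet_Ioi (a := a ^ 2)) hFa
  simpa using this

/-- The fibre integral over `a` decays like `1 / (1 + V)`. -/
theorem lintegral_slice_le (V p : ℝ) (hV : 0 ≤ V) (hp : 0 < p) :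
    ∫⁻ a in {a : ℝ | a ^ 2 < p}, ENNReal.ofReal (exp (-((2 * V * a - p) ^ 2 / (8 * p)))) ≤
      ENNReal.ofReal (6 * (1 + V)⁻¹ * √p) := by
  rcases le_total V 1 with h | h
  · have hset : {a : ℝ | a ^ 2 < p} = Ioo (-√p) (√p) := by
      ext a
      simp [sq_lt]
    calc
      _ ≤ ∫⁻ a in {a : ℝ | a ^ 2 < p}, 1 := by
        refine lintegral_mono fun a => ?_
        rw [ENNReal.ofReal_le_one, exp_le_one_iff, neg_nonpos]
        positivity
      _ = ENNReal.ofReal (2 * √p) := by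
        rw [lintegral_one, Measure.restrict_apply_univ, hset, Real.volume_Ioo]
        ring_nf
      _ ≤ _ := by
        refine ENNReal.ofReal_le_ofReal (mul_le_mul_of_nonneg_right ?_ (sqrt_nonneg p))
        rw [← div_eq_mul_inv, le_div_iff₀ (by linarith)]
        linarith
  · have hV0 : 0 < V := by linarith
    set c : ℝ := V ^ 2 / (2 * p) with hc
    have hc0 : 0 < c := by positivity
    have hsquare (a : ℝ) : -((2 * V * a - p) ^ 2 / (8 * p)) = -c * (a - p / (2 * V)) ^ 2 := by
      rw [hc]
      field_simp
      ring
    simp_rw [hsquare]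
    calc
      _ ≤ ∫⁻ a : ℝ, ENNReal.ofReal (exp (-c * (a - p / (2 * V)) ^ 2)) := setLIntegral_le_lintegral _ _
      _ = ∫⁻ a : ℝ, ENNReal.ofReal (exp (-c * a ^ 2)) :=
        lintegral_sub_right_eq_self (fun a => ENNReal.ofReal (exp (-c * a ^ 2))) _
      _ = ENNReal.ofReal (√(π / c)) := by
        rw [← integral_gaussian, ofReal_integral_eq_lintegral_ofReal (integrable_exp_neg_mul_sq hc0)
          (ae_of_all _ fun a => (exp_pos _).le)]
      _ ≤ _ := by
        refine ENNReal.ofReal_le_ofReal (sqrt_le_iff.2 ⟨by positivity, ?_⟩)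
        rw [mul_pow, sq_sqrt hp.le, hc, div_div_eq_mul_div, div_le_iff₀ (by positivity), mul_pow,
          inv_pow]
        have h1 : (1 + V) ^ 2 ≤ 4 * V ^ 2 := by nlinarith
        have h2 : 1 / 4 ≤ ((1 + V) ^ 2)⁻¹ * V ^ 2 := by
          rw [inv_mul_eq_div, le_div_iff₀ (by positivity)]
          linarith
        nlinarith [pi_lt_four, pi_pos, mul_le_mul_of_nonneg_left h2 hp.le]

theorem lintegral_rpow_neg_half_mul_exp_lt_top :
    ∫⁻ p in Ioi (0 : ℝ), ENNReal.ofReal (p⁻¹ * √p * exp (-(p / 32))) < ∞ := by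
  have h := integrableOn_rpow_mul_exp_neg_mul_rpow (p := 1) (s := -(1 / 2)) (b := 1 / 32)
    (by norm_num) one_pos (by norm_num)
  refine lt_of_le_of_lt (le_of_eq ?_) h.lintegral_lt_top
  refine setLIntegral_congr_fun measurableSet_Ioi fun p hp => ?_
  have hp' : (0 : ℝ) < p := hp
  simp only [rpow_one]
  congr 2
  · rw [sqrt_eq_rpow, ← rpow_neg_one, ← rpow_add hp']
    norm_num
  · ring_nf

/-- Integral estimate for the gain kernel, with its singularity replaced by `|u|⁻²`. -/
theorem lintegral_gain_le :
    ∃ K : ℝ, 0 < K ∧ ∀ v : EuclideanSpace ℝ (Fin 3),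
      ∫⁻ u : EuclideanSpace ℝ (Fin 3), ENNReal.ofReal ((‖u‖ ^ 2)⁻¹ * exp (-(‖u‖ ^ 2 / 32)) *
        exp (-((2 * inner ℝ v u - ‖u‖ ^ 2) ^ 2 / (8 * ‖u‖ ^ 2)))) ≤
      ENNReal.ofReal (K * (1 + ‖v‖)⁻¹) := by
  set I := ∫⁻ p in Ioi (0 : ℝ), ENNReal.ofReal (p⁻¹ * √p * exp (-(p / 32))) with hI
  have hItop : I ≠ ∞ := lintegral_rpow_neg_half_mul_exp_lt_top.ne
  refine ⟨π * 6 * (I.toReal + 1), by positivity, fun v => ?_⟩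
  obtain ⟨e, he, hve⟩ : ∃ e : EuclideanSpace ℝ (Fin 3), ‖e‖ = 1 ∧ v = ‖v‖ • e := by
    by_cases hv : v = 0
    · exact ⟨EuclideanSpace.single 0 1, by simp, by simp [hv]⟩
    · exact ⟨‖v‖⁻¹ • v, norm_smul_inv_norm hv, by
        rw [smul_smul, mul_inv_cancel₀ (norm_ne_zero_iff.2 hv), one_smul]⟩
  set V := ‖v‖ with hVdef
  have hV : 0 ≤ V := norm_nonneg v
  have hinner (u : EuclideanSpace ℝ (Fin 3)) : inner ℝ v u = V * inner ℝ e u := by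
    conv_lhs => rw [hve, real_inner_smul_left]
  let F : ℝ → ℝ → ℝ≥0∞ := fun a p => ENNReal.ofReal (p⁻¹ * exp (-(p / 32)) *
    exp (-((2 * V * a - p) ^ 2 / (8 * p))))
  have hF : Measurable (Function.uncurry F) := by
    unfold F Function.uncurry
    fun_prop
  have hS : MeasurableSet {x : ℝ × ℝ | x.1 ^ 2 < x.2} :=
    measurableSet_lt (by fun_prop) (by fun_prop)
  have hswap : ∫⁻ a : ℝ, ∫⁻ p in Ioi (a ^ 2), F a p =
      ∫⁻ p : ℝ, ∫⁻ a in {a : ℝ | a ^ 2 < p}, F a p := by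
    have h1 (a : ℝ) : ∫⁻ p in Ioi (a ^ 2), F a p =
        ∫⁻ p, {x : ℝ × ℝ | x.1 ^ 2 < x.2}.indicator (Function.uncurry F) (a, p) := by
      rw [← lintegral_indicator measurableSet_Ioi]
      rfl
    have h2 (p : ℝ) : ∫⁻ a in {a : ℝ | a ^ 2 < p}, F a p =
        ∫⁻ a, {x : ℝ × ℝ | x.1 ^ 2 < x.2}.indicator (Function.uncurry F) (a, p) := by
      rw [← lintegral_indicator (measurableSet_lt (by fun_prop) (by fun_prop))]
      rfl
    simp_rw [h1, h2]
    exact lintegral_lintegral_swap (hF.indicator hS).aemeasurable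
  have hslice (p : ℝ) : ∫⁻ a in {a : ℝ | a ^ 2 < p}, F a p ≤
      (Ioi (0 : ℝ)).indicator (fun p => ENNReal.ofReal (6 * (1 + V)⁻¹) *
        ENNReal.ofReal (p⁻¹ * √p * exp (-(p / 32)))) p := by
    by_cases hp : 0 < p
    · rw [indicator_of_mem (mem_Ioi.2 hp)]
      have hpos : 0 ≤ p⁻¹ * exp (-(p / 32)) := by positivity
      simp only [F, ENNReal.ofReal_mul hpos]
      rw [lintegral_const_mul' _ _ ENNReal.ofReal_ne_top]
      refine (mul_le_mul_right (lintegral_slice_le V p hV hp) _).trans (le_of_eq ?_)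
      rw [← ENNReal.ofReal_mul hpos, ← ENNReal.ofReal_mul (by positivity)]
      ring_nf
    · have : {a : ℝ | a ^ 2 < p} = ∅ := by
        ext a
        simp only [mem_ofPred_eq, mem_empty_iff_false, iff_false]
        nlinarith [sq_nonneg a]
      simp [this]
  calc
    _ = ∫⁻ u : EuclideanSpace ℝ (Fin 3), F (inner ℝ e u) (‖u‖ ^ 2) := by
      refine lintegral_congr fun u => ?_
      simp only [F, hinner, mul_assoc]
    _ = ENNReal.ofReal π * ∫⁻ p : ℝ, ∫⁻ a in {a : ℝ | a ^ 2 < p}, F a p := by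
      rw [lintegral_comp_inner_normSq F hF e he, hswap]
    _ ≤ ENNReal.ofReal π * (ENNReal.ofReal (6 * (1 + V)⁻¹) * I) := by
      refine mul_le_mul_right ((lintegral_mono hslice).trans (le_of_eq ?_)) _
      rw [lintegral_indicator measurableSet_Ioi, lintegral_const_mul' _ _ ENNReal.ofReal_ne_top]
    _ ≤ _ := by
      rw [← ENNReal.ofReal_toReal hItop, ← ENNReal.ofReal_mul (by positivity),
        ← ENNReal.ofReal_mul (by positivity)]
      refine ENNReal.ofReal_le_ofReal ?_
      rw [ENNReal.toReal_ofReal ENNReal.toReal_nonneg]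
      have : 0 ≤ π * 6 * (1 + V)⁻¹ := by positivity
      linarith

theorem one_add_rpow_le_exp (ℓ c : ℝ) (hℓ : 0 ≤ ℓ) (hc : 0 < c) :
    ∃ A : ℝ, 0 < A ∧ ∀ x : ℝ, 0 ≤ x → (1 + x) ^ (ℓ + 1) ≤ A * exp (c * x) := by
  have hm : 0 < ℓ + 1 := by linarith
  refine ⟨((ℓ + 1) / c) ^ (ℓ + 1) * exp c, by positivity, fun x hx => ?_⟩
  have h1 : 1 + x ≤ (ℓ + 1) / c * exp (c * (1 + x) / (ℓ + 1)) := by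
    have h := add_one_le_exp (c * (1 + x) / (ℓ + 1))
    calc 1 + x = (ℓ + 1) / c * (c * (1 + x) / (ℓ + 1)) := by field_simp
      _ ≤ _ := mul_le_mul_of_nonneg_left (by linarith) (by positivity)
  calc (1 + x) ^ (ℓ + 1) ≤ ((ℓ + 1) / c * exp (c * (1 + x) / (ℓ + 1))) ^ (ℓ + 1) :=
        rpow_le_rpow (by linarith) h1 hm.le
    _ = ((ℓ + 1) / c) ^ (ℓ + 1) * exp (c * (1 + x)) := by
        rw [mul_rpow (by positivity) (exp_pos _).le, ← exp_mul, div_mul_cancel₀ _ hm.ne']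
    _ = _ := by rw [mul_add, exp_add, mul_one, mul_assoc]

theorem rpow_le_two_mul_one_add_sq {γ r : ℝ} (hγ : γ ∈ Icc (0 : ℝ) 1) (hr : 0 ≤ r) :
    r ^ γ ≤ 2 * (1 + r ^ 2) := by
  calc r ^ γ ≤ (1 + r) ^ γ := rpow_le_rpow hr (by linarith) hγ.1
    _ ≤ (1 + r) ^ (1 : ℝ) := rpow_le_rpow_of_exponent_le (by linarith) hγ.2
    _ ≤ 2 * (1 + r ^ 2) := by
      rw [rpow_one]
      nlinarith [sq_nonneg (r - 1)]

theorem one_add_normSq_le_mul {E : Type*} [SeminormedAddCommGroup E] (v w : E) :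
    1 + ‖v‖ ^ 2 ≤ 2 * (1 + ‖v - w‖ ^ 2) * (1 + ‖w‖ ^ 2) := by
  have h : ‖v‖ ≤ ‖v - w‖ + ‖w‖ := by simpa using norm_add_le (v - w) w
  have h2 : ‖v‖ ^ 2 ≤ (‖v - w‖ + ‖w‖) ^ 2 := pow_le_pow_left₀ (norm_nonneg v) h 2
  nlinarith [sq_nonneg (‖v - w‖ - ‖w‖), mul_nonneg (sq_nonneg ‖v - w‖) (sq_nonneg ‖w‖)]

theorem normSq_sub_le {E : Type*} [SeminormedAddCommGroup E] (v w : E) :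
    ‖v - w‖ ^ 2 ≤ 2 * (‖v‖ ^ 2 + ‖w‖ ^ 2) := by
  have h2 : ‖v - w‖ ^ 2 ≤ (‖v‖ + ‖w‖) ^ 2 := pow_le_pow_left₀ (norm_nonneg _) (norm_sub_le v w) 2
  nlinarith [sq_nonneg (‖v‖ - ‖w‖)]

theorem weighted_gain_le {E : Type*} [NormedAddCommGroup E] [InnerProductSpace ℝ E]
    {γ ℓ ε A : ℝ} (hγ : γ ∈ Icc (0 : ℝ) 1) (hℓ : 0 ≤ ℓ) (hε : ε ≤ 1)
    (hA : ∀ x : ℝ, 0 ≤ x → (1 + x) ^ (ℓ + 1) ≤ A * exp (1 / 32 * x)) (v w : E) :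
    (1 + ‖v‖ ^ 2) ^ ℓ * (‖v - w‖ ^ (γ - 2) * exp (-‖v - w‖ ^ 2 / 8 -
        (‖v‖ ^ 2 - ‖w‖ ^ 2) ^ 2 / (8 * ‖v - w‖ ^ 2))) * ((1 + ‖w‖ ^ 2) ^ ℓ)⁻¹ *
        exp (ε * ‖v - w‖ ^ 2 / 16) ≤
      2 ^ (ℓ + 1) * A * ((‖v - w‖ ^ 2)⁻¹ * exp (-(‖v - w‖ ^ 2 / 32)) *
        exp (-((2 * inner ℝ v (v - w) - ‖v - w‖ ^ 2) ^ 2 / (8 * ‖v - w‖ ^ 2)))) := by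
  have hcross : 2 * inner ℝ v (v - w) - ‖v - w‖ ^ 2 = ‖v‖ ^ 2 - ‖w‖ ^ 2 := by
    rw [norm_sub_sq_real, inner_sub_right, real_inner_self_eq_norm_sq]
    ring
  rw [hcross]
  have hweight : (1 + ‖v‖ ^ 2) ^ ℓ * ((1 + ‖w‖ ^ 2) ^ ℓ)⁻¹ ≤ 2 ^ ℓ * (1 + ‖v - w‖ ^ 2) ^ ℓ := by
    rw [← div_eq_mul_inv, div_le_iff₀ (by positivity), ← mul_rpow (by norm_num) (by positivity),
      ← mul_rpow (by positivity) (by positivity)]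
    exact rpow_le_rpow (by positivity) (one_add_normSq_le_mul v w) hℓ
  set r := ‖v - w‖ with hr
  set D := (‖v‖ ^ 2 - ‖w‖ ^ 2) ^ 2 / (8 * r ^ 2) with hD
  have hr0 : 0 ≤ r := norm_nonneg _
  have hsing : r ^ (γ - 2) ≤ 2 * (1 + r ^ 2) * (r ^ 2)⁻¹ := by
    rcases hr0.eq_or_lt with h | h
    · rw [← h, zero_rpow (by linarith [hγ.2])]
      positivity
    · rw [rpow_sub h, rpow_two, div_eq_mul_inv]
      exact mul_le_mul_of_nonneg_right (rpow_le_two_mul_one_add_sq hγ hr0) (by positivity)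
  have hexp : exp (-r ^ 2 / 8 - D) * exp (ε * r ^ 2 / 16) ≤ exp (-(r ^ 2 / 16)) * exp (-D) := by
    rw [← exp_add, ← exp_add, exp_le_exp]
    nlinarith [mul_le_mul_of_nonneg_right hε (sq_nonneg r)]
  calc _ = ((1 + ‖v‖ ^ 2) ^ ℓ * ((1 + ‖w‖ ^ 2) ^ ℓ)⁻¹) * r ^ (γ - 2) *
        (exp (-r ^ 2 / 8 - D) * exp (ε * r ^ 2 / 16)) := by ring
    _ ≤ (2 ^ ℓ * (1 + r ^ 2) ^ ℓ) * (2 * (1 + r ^ 2) * (r ^ 2)⁻¹) *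
        (exp (-(r ^ 2 / 16)) * exp (-D)) := by gcongr
    _ = 2 ^ (ℓ + 1) * (1 + r ^ 2) ^ (ℓ + 1) * ((r ^ 2)⁻¹ * exp (-(r ^ 2 / 16)) * exp (-D)) := by
      rw [rpow_add_one (by norm_num), rpow_add_one (by positivity)]
      ring
    _ ≤ 2 ^ (ℓ + 1) * (A * exp (1 / 32 * r ^ 2)) *
        ((r ^ 2)⁻¹ * exp (-(r ^ 2 / 16)) * exp (-D)) := by
      gcongr
      exact hA _ (sq_nonneg r)
    _ = _ := by
      have : exp (-(r ^ 2 / 32)) = exp (1 / 32 * r ^ 2) * exp (-(r ^ 2 / 16)) := by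
        rw [← exp_add]
        ring_nf
      rw [this]
      ring

theorem weighted_loss_le {E : Type*} [SeminormedAddCommGroup E]
    {γ ℓ ε A : ℝ} (hγ : γ ∈ Icc (0 : ℝ) 1) (hℓ : 0 ≤ ℓ) (hε : ε ≤ 1)
    (hA : ∀ x : ℝ, 0 ≤ x → (1 + x) ^ (ℓ + 1) ≤ A * exp (1 / 32 * x)) (v w : E) :
    (1 + ‖v‖ ^ 2) ^ ℓ * (‖v - w‖ ^ γ * exp (-(‖v‖ ^ 2 + ‖w‖ ^ 2) / 4)) * ((1 + ‖w‖ ^ 2) ^ ℓ)⁻¹ *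
        exp (ε * ‖v - w‖ ^ 2 / 16) ≤
      8 * A ^ 3 * (1 + ‖v‖)⁻¹ * exp (-(1 / 16) * ‖w‖ ^ 2) := by
  have hlin (x : ℝ) (hx : 0 ≤ x) : 1 + x ≤ A * exp (1 / 32 * x) := by
    refine le_trans ?_ (hA x hx)
    exact self_le_rpow_of_one_le (by linarith) (by linarith)
  have hA0 : 0 ≤ A := by
    have := hlin 0 le_rfl
    simp at this
    linarith
  have hsub := normSq_sub_le v w
  have hr := rpow_le_two_mul_one_add_sq hγ (norm_nonneg (v - w))
  have hinv : ((1 + ‖w‖ ^ 2) ^ ℓ)⁻¹ ≤ 1 :=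
    inv_le_one_of_one_le₀ (one_le_rpow (by linarith [sq_nonneg ‖w‖]) hℓ)
  set r := ‖v - w‖
  set V := ‖v‖
  set W := ‖w‖
  have hV : 0 ≤ V := norm_nonneg v
  have hrγ : r ^ γ ≤ 4 * (1 + V ^ 2) * (1 + W ^ 2) := by
    nlinarith [mul_nonneg (sq_nonneg V) (sq_nonneg W)]
  have hexp : exp (-(V ^ 2 + W ^ 2) / 4) * exp (ε * r ^ 2 / 16) ≤
      exp (-(1 / 8) * (V ^ 2 + W ^ 2)) := by
    rw [← exp_add, exp_le_exp]
    nlinarith [mul_le_mul_of_nonneg_right hε (sq_nonneg r)]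
  have hdecay : exp (-(1 / 32) * V ^ 2) ≤ 2 * A * (1 + V)⁻¹ := by
    rw [neg_mul, exp_neg, ← div_eq_mul_inv, inv_eq_one_div, div_le_div_iff₀ (exp_pos _) (by linarith)]
    nlinarith [hlin (V ^ 2) (sq_nonneg V), sq_nonneg (V - 1)]
  calc _ = (1 + V ^ 2) ^ ℓ * r ^ γ * ((1 + W ^ 2) ^ ℓ)⁻¹ *
        (exp (-(V ^ 2 + W ^ 2) / 4) * exp (ε * r ^ 2 / 16)) := by ring
    _ ≤ (1 + V ^ 2) ^ ℓ * (4 * (1 + V ^ 2) * (1 + W ^ 2)) * 1 *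
        exp (-(1 / 8) * (V ^ 2 + W ^ 2)) := by gcongr
    _ = 4 * (1 + V ^ 2) ^ (ℓ + 1) * (1 + W ^ 2) * exp (-(1 / 8) * (V ^ 2 + W ^ 2)) := by
      rw [rpow_add_one (by positivity)]
      ring
    _ ≤ 4 * (A * exp (1 / 32 * V ^ 2)) * (A * exp (1 / 32 * W ^ 2)) *
        exp (-(1 / 8) * (V ^ 2 + W ^ 2)) := by
      gcongr
      · exact hA _ (sq_nonneg V)
      · exact hlin _ (sq_nonneg W)
    _ = 4 * A ^ 2 * exp (1 / 32 * V ^ 2 + 1 / 32 * W ^ 2 + -(1 / 8) * (V ^ 2 + W ^ 2)) := by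
      rw [exp_add, exp_add]
      ring
    _ ≤ 4 * A ^ 2 * exp (-(1 / 32) * V ^ 2 + -(1 / 16) * W ^ 2) := by
      refine mul_le_mul_of_nonneg_left (exp_le_exp.2 ?_) (by positivity)
      linarith [sq_nonneg V, sq_nonneg W]
    _ ≤ 4 * A ^ 2 * ((2 * A * (1 + V)⁻¹) * exp (-(1 / 16) * W ^ 2)) := by
      rw [exp_add]
      gcongr
    _ = _ := by ring

theorem integrable_exp_neg_mul_normSq {V : Type*} [NormedAddCommGroup V] [InnerProductSpace ℝ V]
    [FiniteDimensional ℝ V] [MeasurableSpace V] [BorelSpace V] {b : ℝ} (hb : 0 < b) :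
    Integrable fun v : V => exp (-b * ‖v‖ ^ 2) := by
  refine Integrable.of_integral_ne_zero ?_
  rw [GaussianFourier.integral_rexp_neg_mul_sq_norm hb]
  positivity

/-- Weighted Grad kernel estimate: with `k_w(v,v*) = w^ℓ(v)(k₂-k₁)(v,v*)w^{-ℓ}(v*)` and a
small exponential factor `e^{ε|v-v*|²/16}`, one has
`∫ |k_w(v,v*)| e^{ε|v-v*|²/16} dv* ≤ C(1+|v|)⁻¹` for all `v`, uniformly for small `ε ≥ 0`. -/
theorem weighted_grad_kernel_estimate (γ ℓ C₁ C₂ : ℝ)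
    (hγ : γ ∈ Set.Icc (0:ℝ) 1) (hℓ : 0 ≤ ℓ) (hC₁ : 0 < C₁) (hC₂ : 0 < C₂) :
    ∃ ε₀ > 0, ∃ C > 0, ∀ ε : ℝ, 0 ≤ ε → ε ≤ ε₀ →
      ∀ v : EuclideanSpace ℝ (Fin 3),
      (∫⁻ w : EuclideanSpace ℝ (Fin 3),
        ENNReal.ofReal
          (|(1 + ‖v‖ ^ 2) ^ ℓ *
              (C₂ * ‖v - w‖ ^ (γ - 2) *
                  Real.exp (-‖v - w‖ ^ 2 / 8 -
                    (‖v‖ ^ 2 - ‖w‖ ^ 2) ^ 2 / (8 * ‖v - w‖ ^ 2))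
                - C₁ * ‖v - w‖ ^ γ * Real.exp (-(‖v‖ ^ 2 + ‖w‖ ^ 2) / 4)) *
              ((1 + ‖w‖ ^ 2) ^ ℓ)⁻¹| *
            Real.exp (ε * ‖v - w‖ ^ 2 / 16)))
        ≤ ENNReal.ofReal (C * (1 + ‖v‖)⁻¹) := by
  obtain ⟨A, hA0, hA⟩ := one_add_rpow_le_exp ℓ (1 / 32) hℓ (by norm_num)
  obtain ⟨K, hK0, hK⟩ := lintegral_gain_le
  have hgauss := integrable_exp_neg_mul_normSq (V := EuclideanSpace ℝ (Fin 3)) (b := 1 / 16)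
    (by norm_num)
  set J := ∫ w : EuclideanSpace ℝ (Fin 3), exp (-(1 / 16) * ‖w‖ ^ 2) with hJ
  have hJ0 : 0 ≤ J := integral_nonneg fun w => (exp_pos _).le
  refine ⟨1, one_pos, C₂ * (2 ^ (ℓ + 1) * A) * K + C₁ * (8 * A ^ 3) * J, by positivity,
    fun ε _ hε v => ?_⟩
  let g : EuclideanSpace ℝ (Fin 3) → ℝ := fun u => (‖u‖ ^ 2)⁻¹ * exp (-(‖u‖ ^ 2 / 32)) *
    exp (-((2 * inner ℝ v u - ‖u‖ ^ 2) ^ 2 / (8 * ‖u‖ ^ 2)))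
  have hg : Measurable g := by
    unfold g
    fun_prop
  have hgain : ∫⁻ w, ENNReal.ofReal (g (v - w)) ≤ ENNReal.ofReal (K * (1 + ‖v‖)⁻¹) := by
    rw [lintegral_sub_left_eq_self (fun u => ENNReal.ofReal (g u))]
    exact hK v
  calc
    _ ≤ ∫⁻ w, (ENNReal.ofReal (C₂ * (2 ^ (ℓ + 1) * A)) * ENNReal.ofReal (g (v - w)) +
        ENNReal.ofReal (C₁ * (8 * A ^ 3 * (1 + ‖v‖)⁻¹)) *
          ENNReal.ofReal (exp (-(1 / 16) * ‖w‖ ^ 2))) := by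
      refine lintegral_mono fun w => ?_
      have hgnn : 0 ≤ g (v - w) := by positivity
      rw [← ENNReal.ofReal_mul (by positivity), ← ENNReal.ofReal_mul (by positivity),
        ← ENNReal.ofReal_add (by positivity) (by positivity)]
      refine ENNReal.ofReal_le_ofReal ?_
      have h2 := mul_le_mul_of_nonneg_left (weighted_gain_le hγ hℓ hε hA v w) hC₂.le
      have h1 := mul_le_mul_of_nonneg_left (weighted_loss_le hγ hℓ hε hA v w) hC₁.le
      rw [abs_mul, abs_mul, abs_of_nonneg (by positivity : 0 ≤ (1 + ‖v‖ ^ 2) ^ ℓ),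
        abs_of_nonneg (by positivity : 0 ≤ ((1 + ‖w‖ ^ 2) ^ ℓ)⁻¹)]
      set P := C₂ * ‖v - w‖ ^ (γ - 2) * exp (-‖v - w‖ ^ 2 / 8 -
        (‖v‖ ^ 2 - ‖w‖ ^ 2) ^ 2 / (8 * ‖v - w‖ ^ 2)) with hP
      set Q := C₁ * ‖v - w‖ ^ γ * exp (-(‖v‖ ^ 2 + ‖w‖ ^ 2) / 4) with hQ
      have hPQ : |P - Q| ≤ P + Q :=
        abs_le.2 ⟨by linarith [show 0 ≤ P by positivity], by linarith [show 0 ≤ Q by positivity]⟩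
      calc _ ≤ (1 + ‖v‖ ^ 2) ^ ℓ * (P + Q) * ((1 + ‖w‖ ^ 2) ^ ℓ)⁻¹ *
            exp (ε * ‖v - w‖ ^ 2 / 16) := by gcongr
        _ = _ := by
          rw [hP, hQ]
          ring
        _ ≤ _ := add_le_add h2 h1
        _ = _ := by
          simp only [g]
          ring
    _ ≤ ENNReal.ofReal (C₂ * (2 ^ (ℓ + 1) * A)) * ENNReal.ofReal (K * (1 + ‖v‖)⁻¹) +
        ENNReal.ofReal (C₁ * (8 * A ^ 3 * (1 + ‖v‖)⁻¹)) * ENNReal.ofReal J := by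
      rw [lintegral_add_left (by fun_prop), lintegral_const_mul' _ _ ENNReal.ofReal_ne_top,
        lintegral_const_mul' _ _ ENNReal.ofReal_ne_top, hJ,
        ofReal_integral_eq_lintegral_ofReal hgauss (ae_of_all _ fun w => (exp_pos _).le)]
      gcongr
    _ = _ := by
      rw [← ENNReal.ofReal_mul (by positivity), ← ENNReal.ofReal_mul (by positivity),
        ← ENNReal.ofReal_add (by positivity) (by positivity)]
      ring_nf
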